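/- arXiv:1806.06233 — 2 statements merged into one kernel-verified Lean document; each statement's English description precedes it below -/
import Mathlib

section
/- There exist absolute constants c₁ and c₂ for which the following holds. Let ‖·‖ be a norm on ℝ^d with dual unit ball B°, let G be a standard Gaussian random vector in ℝ^d with law ν, let D = B₂^d be the Euclidean unit ball, and let n ≤ N. Assume log M(B°, ηD) ≥ c₁ n. Then there is a finite set T ⊂ ℝ^d such that no mean estimator Ψ̂_N : (ℝ^d)^N → ℝ^d satisfies simultaneously for every t ∈ T: P(‖Ψ̂_N(X₁,…,X_N) − t‖ ≤ c₂ η √(n/N)) ≥ 1/2 when X₁,…,X_N are i.i.d. with the law of G + t. That is, any estimator performing with confidence 1/2 with respect to all the Gaussian measures {G + t : t ∈ T} cannot have accuracy better than c₂ η √(n/N). -/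
open MeasureTheory ProbabilityTheory
open scoped ENNReal

/-- The unit ball of the dual norm of `nrm`, identifying linear functionals on `ℝ^d`
with vectors via the standard inner product. -/
def dualBall {d : ℕ} (nrm : (Fin d → ℝ) → ℝ) : Set (Fin d → ℝ) :=
  {t | ∀ x, nrm x ≤ 1 → ∑ i, t i * x i ≤ 1}

/-- The standard Gaussian measure on `ℝ^d`. -/
noncomputable def stdGaussian (d : ℕ) : Measure (Fin d → ℝ) :=
  Measure.pi fun _ : Fin d => gaussianReal 0 1


/-- `Q` has a density with respect to `P` whose second moment is at most `C`. -/
def HasSqDensity {α : Type*} [MeasurableSpace α] (P Q : Measure α) (C : ℝ≥0∞) : Prop :=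
  ∃ f : α → ℝ≥0∞, Measurable f ∧ Q = P.withDensity f ∧ ∫⁻ x, f x ^ 2 ∂P ≤ C

lemma HasSqDensity.sq_measure_le {α : Type*} [MeasurableSpace α] {P Q : Measure α} {C : ℝ≥0∞}
    (h : HasSqDensity P Q C) {A : Set α} (hA : MeasurableSet A) : Q A ^ 2 ≤ C * P A := by
  obtain ⟨f, hf, rfl, hC⟩ := h
  have hQ : P.withDensity f A = ∫⁻ x, (f * A.indicator (1 : α → ℝ≥0∞)) x ∂P := by
    rw [withDensity_apply _ hA, ← lintegral_indicator hA]
    refine lintegral_congr fun x => ?_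
    by_cases hx : x ∈ A <;> simp [hx]
  have hind : ∫⁻ x, (A.indicator (1 : α → ℝ≥0∞) x) ^ (2 : ℝ) ∂P = P A := by
    rw [← lintegral_indicator_one hA]
    refine lintegral_congr fun x => ?_
    by_cases hx : x ∈ A <;> simp [hx]
  have hH := ENNReal.lintegral_mul_le_Lp_mul_Lq P Real.HolderConjugate.two_two hf.aemeasurable
    ((measurable_one.indicator hA).aemeasurable (μ := P))
  rw [hind, ← hQ] at hH
  calc P.withDensity f A ^ 2
      ≤ ((∫⁻ x, f x ^ (2 : ℝ) ∂P) ^ (1 / 2 : ℝ) * P A ^ (1 / 2 : ℝ)) ^ 2 := by gcongr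
    _ = (∫⁻ x, f x ^ 2 ∂P) * P A := by
        rw [mul_pow, ← ENNReal.rpow_mul_natCast, ← ENNReal.rpow_mul_natCast]
        norm_num
    _ ≤ C * P A := by gcongr

lemma pi_withDensity {ι : Type*} [Fintype ι] {α : ι → Type*} [∀ i, MeasurableSpace (α i)]
    (μ : ∀ i, Measure (α i)) [∀ i, IsProbabilityMeasure (μ i)] {f : ∀ i, α i → ℝ≥0∞}
    (hf : ∀ i, Measurable (f i)) [∀ i, SigmaFinite ((μ i).withDensity (f i))] :
    Measure.pi (fun i => (μ i).withDensity (f i)) =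
      (Measure.pi μ).withDensity fun x => ∏ i, f i (x i) := by
  refine Measure.pi_eq fun s hs => ?_
  have hm : ∀ i, Measurable ((s i).indicator (f i)) := fun i => (hf i).indicator (hs i)
  rw [withDensity_apply _ (MeasurableSet.univ_pi hs),
    ← lintegral_indicator (MeasurableSet.univ_pi hs)]
  have hind : ∀ x : ∀ i, α i, (Set.univ.pi s).indicator (fun x => ∏ i, f i (x i)) x =
      ∏ i, (s i).indicator (f i) (x i) := by
    intro x
    by_cases hx : x ∈ Set.univ.pi s
    · rw [Set.indicator_of_mem hx]
      exact Finset.prod_congr rfl fun i _ => (Set.indicator_of_mem (hx i trivial) _).symm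
    · rw [Set.indicator_of_notMem hx]
      simp only [Set.mem_univ_pi, not_forall] at hx
      obtain ⟨i, hi⟩ := hx
      exact (Finset.prod_eq_zero (Finset.mem_univ i) (Set.indicator_of_notMem hi _)).symm
  simp_rw [hind]
  rw [lintegral_prod_eq_prod_lintegral_of_indepFun Finset.univ
    (fun i (x : ∀ i, α i) => (s i).indicator (f i) (x i))
    (iIndepFun_pi fun i => (hm i).aemeasurable) fun i => (hm i).comp (measurable_pi_apply i)]
  refine Finset.prod_congr rfl fun i _ => ?_
  rw [← (measurePreserving_eval μ i).lintegral_comp (hm i) |>.symm, lintegral_indicator (hs i),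
    withDensity_apply _ (hs i)]

lemma HasSqDensity.pi {ι : Type*} [Fintype ι] {α : ι → Type*} [∀ i, MeasurableSpace (α i)]
    {P Q : ∀ i, Measure (α i)} [∀ i, IsProbabilityMeasure (P i)]
    [hQ : ∀ i, IsProbabilityMeasure (Q i)] {C : ι → ℝ≥0∞} (h : ∀ i, HasSqDensity (P i) (Q i) (C i)) :
    HasSqDensity (Measure.pi P) (Measure.pi Q) (∏ i, C i) := by
  choose f hf hd hC using h
  obtain rfl : Q = fun i => (P i).withDensity (f i) := funext hd
  have hm : ∀ i, Measurable fun x => f i x ^ 2 := fun i => (hf i).pow_const 2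
  refine ⟨fun x => ∏ i, f i (x i),
    Finset.measurable_prod _ fun i _ => (hf i).comp (measurable_pi_apply i),
    pi_withDensity P hf, ?_⟩
  simp_rw [← Finset.prod_pow]
  rw [lintegral_prod_eq_prod_lintegral_of_indepFun Finset.univ
    (fun i (x : ∀ i, α i) => f i (x i) ^ 2)
    (iIndepFun_pi (X := fun i x => f i x ^ 2) fun i => (hm i).aemeasurable)
    fun i => (hm i).comp (measurable_pi_apply i)]
  refine Finset.prod_le_prod' fun i _ => ?_
  rw [(measurePreserving_eval P i).lintegral_comp (hm i)]
  exact hC i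

lemma hasSqDensity_gaussianReal (m : ℝ) :
    HasSqDensity (gaussianReal 0 1) (gaussianReal m 1) (ENNReal.ofReal (Real.exp (m ^ 2))) := by
  have hmeas : Measurable fun x : ℝ => ENNReal.ofReal (Real.exp (m * x - m ^ 2 / 2)) := by fun_prop
  refine ⟨_, hmeas, ?_, ?_⟩
  · rw [gaussianReal_of_var_ne_zero _ one_ne_zero, gaussianReal_of_var_ne_zero _ one_ne_zero,
      ← withDensity_mul _ (measurable_gaussianPDF 0 1) hmeas]
    congr 1
    ext x
    rw [Pi.mul_apply, gaussianPDF, gaussianPDF,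
      ← ENNReal.ofReal_mul (gaussianPDFReal_nonneg _ _ _), gaussianPDFReal, gaussianPDFReal,
      mul_assoc (Real.sqrt _)⁻¹, ← Real.exp_add]
    congr 3
    simp only [NNReal.coe_one]
    ring
  · have hsq : ∀ x : ℝ, ENNReal.ofReal (Real.exp (m * x - m ^ 2 / 2)) ^ 2 =
        ENNReal.ofReal (Real.exp (-m ^ 2) * Real.exp (2 * m * x)) := by
      intro x
      rw [← ENNReal.ofReal_pow (Real.exp_nonneg _), ← Real.exp_nat_mul, ← Real.exp_add]
      congr 2
      push_cast
      ring
    simp_rw [hsq]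
    rw [← ofReal_integral_eq_lintegral_ofReal
      ((integrable_exp_mul_gaussianReal (2 * m)).const_mul _)
      (ae_of_all _ fun x => by positivity), integral_const_mul]
    have hmgf := congrFun (mgf_id_gaussianReal (μ := 0) (v := 1)) (2 * m)
    simp only [mgf, id] at hmgf
    rw [hmgf, ← Real.exp_add]
    refine ENNReal.ofReal_le_ofReal (Real.exp_le_exp.2 (le_of_eq ?_))
    simp only [NNReal.coe_one]
    ring

lemma map_add_stdGaussian {d : ℕ} (t : Fin d → ℝ) :
    Measure.map (fun x => x + t) (_root_.stdGaussian d) =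
      Measure.pi fun i => gaussianReal (t i) 1 := by
  have h := Measure.pi_map_pi (μ := fun _ : Fin d => gaussianReal 0 1)
    (f := fun i (x : ℝ) => x + t i) fun i => (measurable_id.add_const (t i)).aemeasurable
  simp only [gaussianReal_map_add_const, zero_add] at h
  exact h

lemma hasSqDensity_gaussian_sample {d : ℕ} (N : ℕ) (t : Fin d → ℝ) :
    HasSqDensity (Measure.pi fun _ : Fin N => _root_.stdGaussian d)
      (Measure.pi fun _ : Fin N => Measure.map (fun x => x + t) (_root_.stdGaussian d))
      (ENNReal.ofReal (Real.exp (N * (t ⬝ᵥ t)))) := by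
  have h1 : HasSqDensity (_root_.stdGaussian d) (Measure.pi fun i => gaussianReal (t i) 1)
      (∏ i, ENNReal.ofReal (Real.exp (t i ^ 2))) :=
    HasSqDensity.pi fun i => hasSqDensity_gaussianReal (t i)
  have : IsProbabilityMeasure (_root_.stdGaussian d) :=
    inferInstanceAs (IsProbabilityMeasure (Measure.pi fun _ : Fin d => gaussianReal 0 1))
  rw [map_add_stdGaussian]
  convert HasSqDensity.pi fun _ : Fin N => h1 using 1
  rw [Finset.prod_const, ← ENNReal.ofReal_prod_of_nonneg fun i _ => Real.exp_nonneg _,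
    ← ENNReal.ofReal_pow (Finset.prod_nonneg fun i _ => Real.exp_nonneg _), ← Real.exp_sum,
    ← Real.exp_nat_mul]
  simp [dotProduct, sq]

/-- Pairwise disjoint events, each of probability at least `1/2` under its own measure, are
at most `4C` in number if all the measures have a density of second moment at most `C` with
respect to a common probability measure. -/
lemma card_le_of_hasSqDensity {α ι : Type*} [MeasurableSpace α] {P : Measure α}
    [IsProbabilityMeasure P] {Q : ι → Measure α} {C : ℝ≥0∞} {T : Finset ι} {A : ι → Set α}
    (hQ : ∀ t ∈ T, HasSqDensity P (Q t) C) (hA : ∀ t ∈ T, MeasurableSet (A t))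
    (hdisj : (T : Set ι).PairwiseDisjoint A) (hhalf : ∀ t ∈ T, 1 / 2 ≤ Q t (A t)) :
    (T.card : ℝ≥0∞) ≤ 4 * C := by
  have h1 : ∀ t ∈ T, (1 : ℝ≥0∞) ≤ 4 * C * P (A t) := by
    intro t ht
    have hq : ((1 / 2 : ℝ≥0∞)) ^ 2 ≤ C * P (A t) :=
      (pow_le_pow_left' (hhalf t ht) 2).trans ((hQ t ht).sq_measure_le (hA t ht))
    calc (1 : ℝ≥0∞) = 4 * (1 / 2) ^ 2 := by
          rw [one_div, ← ENNReal.inv_pow, show (2 : ℝ≥0∞) ^ 2 = 4 by norm_num,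
            ENNReal.mul_inv_cancel (by norm_num) (by norm_num)]
      _ ≤ 4 * (C * P (A t)) := by gcongr
      _ = 4 * C * P (A t) := (mul_assoc _ _ _).symm
  calc (T.card : ℝ≥0∞) = ∑ t ∈ T, 1 := by simp
    _ ≤ ∑ t ∈ T, 4 * C * P (A t) := Finset.sum_le_sum h1
    _ = 4 * C * P (⋃ t ∈ T, A t) := by
        rw [measure_biUnion_finset hdisj hA, Finset.mul_sum]
    _ ≤ 4 * C * 1 := by gcongr; exact prob_le_one
    _ = 4 * C := mul_one _

lemma card_le_of_shrinking_radius {d : ℕ} {p : (Fin d → ℝ) → ℝ}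
    (hp : ∀ (a : ℝ) x, p (a • x) = |a| * p x)
    (hpack : ∀ (ρ : ℝ) (T : Finset (Fin d → ℝ)), (∀ t ∈ T, t ⬝ᵥ t ≤ ρ) →
      (∀ t ∈ T, ∀ u ∈ T, t ≠ u → 2 < p (t - u)) → (T.card : ℝ) ≤ 4 * Real.exp ρ)
    {b : ℝ} (hb : 0 < b) {F : Finset (Fin d → ℝ)} (hF : ∀ z ∈ F, ∀ x, z ⬝ᵥ x ≤ p x)
    (hsep : ∀ x ∈ F, ∀ y ∈ F, x ≠ y → b ≤ (x - y) ⬝ᵥ (x - y))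
    (y : Fin d → ℝ) (hy : ∀ x ∈ F, (x - y) ⬝ᵥ (x - y) ≤ 4 * b) :
    (F.card : ℝ) ≤ 4 * Real.exp (100 / b) := by
  have hl : (0 : ℝ) < 5 / b := by positivity
  have hinj : Function.Injective fun x : Fin d → ℝ => (5 / b) • (x - y) := by
    intro x x' hx
    exact sub_left_injective (smul_right_injective _ hl.ne' hx)
  rw [← Finset.card_image_of_injective F hinj]
  refine hpack _ _ ?_ ?_
  · simp only [Finset.forall_mem_image, smul_dotProduct, dotProduct_smul, smul_eq_mul]
    intro x hx
    calc 5 / b * (5 / b * ((x - y) ⬝ᵥ (x - y))) ≤ 5 / b * (5 / b * (4 * b)) := by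
          gcongr; exact hy x hx
      _ = 100 / b := by field_simp; norm_num
  · simp only [Finset.forall_mem_image]
    intro x hx x' hx' hne
    have hxx : x ≠ x' := fun h => hne (by rw [h])
    have h1 := hsep x hx x' hx' hxx
    have h2 := hF x hx (x - x')
    have h3 := hF x' hx' (x' - x)
    have h4 : p (x' - x) = p (x - x') := by
      have := hp (-1) (x - x')
      simpa using this
    have h5 : (x - x') ⬝ᵥ (x - x') = x ⬝ᵥ (x - x') + x' ⬝ᵥ (x' - x) := by
      rw [sub_dotProduct, ← neg_sub x x', dotProduct_neg]; ring
    rw [← smul_sub, sub_sub_sub_cancel_right, hp, abs_of_pos hl]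
    have h6 : b / 2 ≤ p (x - x') := by linarith
    calc (2 : ℝ) < 5 / b * (b / 2) := by field_simp; norm_num
      _ ≤ _ := by gcongr

lemma dotProduct_self_le_of_packing {d : ℕ} {p : (Fin d → ℝ) → ℝ}
    (hp : ∀ (a : ℝ) x, p (a • x) = |a| * p x)
    (hpack : ∀ (ρ : ℝ) (T : Finset (Fin d → ℝ)), (∀ t ∈ T, t ⬝ᵥ t ≤ ρ) →
      (∀ t ∈ T, ∀ u ∈ T, t ≠ u → 2 < p (t - u)) → (T.card : ℝ) ≤ 4 * Real.exp ρ)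
    {z : Fin d → ℝ} (hz : ∀ x, z ⬝ᵥ x ≤ p x) : z ⬝ᵥ z ≤ 900 := by
  by_contra! hbig
  have hpos : 0 < z ⬝ᵥ z := by linarith
  have hz1 : z ⬝ᵥ z ≤ p z := hz z
  let g : ℕ → Fin d → ℝ := fun j => ((j : ℝ) * (5 / 2 / (z ⬝ᵥ z))) • z
  have hg : ∀ i j : ℕ, i ≠ j → 2 < p (g i - g j) := by
    intro i j hij
    have h1 : (1 : ℝ) ≤ |(i : ℝ) - j| := by
      have : (1 : ℤ) ≤ |(i : ℤ) - j| := Int.one_le_abs (by omega)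
      exact_mod_cast this
    simp only [g]
    rw [← sub_smul, ← sub_mul, hp, abs_mul, abs_of_pos (show 0 < 5 / 2 / (z ⬝ᵥ z) by positivity)]
    calc (2 : ℝ) < 1 * (5 / 2 / (z ⬝ᵥ z)) * (z ⬝ᵥ z) := by field_simp; norm_num
      _ ≤ _ := by gcongr
  have hp0 : p 0 = 0 := by simpa using hp 0 0
  have hinj : Function.Injective g := by
    intro i j hij
    by_contra hne
    have := hg i j hne
    rw [hij, sub_self, hp0] at this
    norm_num at this
  have hcard := hpack (1 / 9) ((Finset.range 5).image g) (by
    simp only [Finset.forall_mem_image, g, smul_dotProduct, dotProduct_smul, smul_eq_mul]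
    intro j hj
    have hj4 : (j : ℝ) ≤ 4 := by
      have : j ≤ 4 := by have := Finset.mem_range.1 hj; omega
      exact_mod_cast this
    calc (j : ℝ) * (5 / 2 / (z ⬝ᵥ z)) * (j * (5 / 2 / (z ⬝ᵥ z)) * (z ⬝ᵥ z))
        ≤ 4 * (5 / 2 / (z ⬝ᵥ z)) * (4 * (5 / 2 / (z ⬝ᵥ z)) * (z ⬝ᵥ z)) := by gcongr
      _ = 100 / (z ⬝ᵥ z) := by field_simp; norm_num
      _ ≤ 1 / 9 := by rw [div_le_div_iff₀ hpos (by norm_num)]; linarith) (by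
    simp only [Finset.forall_mem_image]
    intro i _ j _ hne
    exact hg i j fun h => hne (by rw [h]))
  rw [Finset.card_image_of_injective _ hinj, Finset.card_range] at hcard
  have hexp := Real.exp_bound_div_one_sub_of_interval (x := 1 / 9) (by norm_num) (by norm_num)
  norm_num at hcard hexp
  linarith

lemma exists_net {d : ℕ} (S : Finset (Fin d → ℝ)) {b : ℝ} (hb : 0 < b) :
    ∃ S' ⊆ S, (∀ x ∈ S', ∀ y ∈ S', x ≠ y → b ≤ (x - y) ⬝ᵥ (x - y)) ∧
      ∀ x ∈ S, ∃ y ∈ S', (x - y) ⬝ᵥ (x - y) ≤ b := by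
  classical
  obtain ⟨S', hS'⟩ := (S.powerset.filter fun R =>
      ∀ x ∈ R, ∀ y ∈ R, x ≠ y → b ≤ (x - y) ⬝ᵥ (x - y)).exists_maximal ⟨∅, by simp⟩
  obtain ⟨hsub, hsep⟩ := Finset.mem_filter.1 hS'.1
  rw [Finset.mem_powerset] at hsub
  refine ⟨S', hsub, hsep, fun x hx => ?_⟩
  by_contra! hfar
  have hx' : x ∉ S' := fun h => by
    have := hfar x h
    simp at this
    linarith
  have hins : insert x S' ∈ S.powerset.filter fun R =>
      ∀ x ∈ R, ∀ y ∈ R, x ≠ y → b ≤ (x - y) ⬝ᵥ (x - y) := by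
    refine Finset.mem_filter.2 ⟨Finset.mem_powerset.2 (Finset.insert_subset hx hsub), ?_⟩
    intro u hu v hv huv
    rcases Finset.mem_insert.1 hu with rfl | hu' <;> rcases Finset.mem_insert.1 hv with rfl | hv'
    · exact absurd rfl huv
    · exact (hfar v hv').le
    · rw [← neg_sub, neg_dotProduct_neg]
      exact (hfar u hu').le
    · exact hsep u hu' v hv' huv
  exact hx' (hS'.2 hins (Finset.subset_insert x S') (Finset.mem_insert_self x S'))

lemma card_le_one_of_packing {d : ℕ} {p : (Fin d → ℝ) → ℝ}
    (hp : ∀ (a : ℝ) x, p (a • x) = |a| * p x)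
    (hpack : ∀ (ρ : ℝ) (T : Finset (Fin d → ℝ)), (∀ t ∈ T, t ⬝ᵥ t ≤ ρ) →
      (∀ t ∈ T, ∀ u ∈ T, t ≠ u → 2 < p (t - u)) → (T.card : ℝ) ≤ 4 * Real.exp ρ)
    {b : ℝ} (hb : 3600 < b) {S : Finset (Fin d → ℝ)} (hS : ∀ z ∈ S, ∀ x, z ⬝ᵥ x ≤ p x)
    (hsep : ∀ x ∈ S, ∀ y ∈ S, x ≠ y → b ≤ (x - y) ⬝ᵥ (x - y)) : S.card ≤ 1 := by
  refine Finset.card_le_one.2 fun x hx y hy => ?_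
  by_contra hne
  have h1 := dotProduct_self_le_of_packing hp hpack (hS x hx)
  have h2 := dotProduct_self_le_of_packing hp hpack (hS y hy)
  have h3 := hsep x hx y hy hne
  have h4 : 0 ≤ (x + y) ⬝ᵥ (x + y) := Finset.sum_nonneg fun i _ => mul_self_nonneg _
  simp only [add_dotProduct, dotProduct_add, sub_dotProduct, dotProduct_sub] at h3 h4
  linarith

/-- A form of Sudakov's inequality: a bound on packings of Euclidean balls with respect to `p`
gives a bound on Euclidean packings of the polar body of `p`. -/
lemma card_le_exp_of_packing {d : ℕ} {p : (Fin d → ℝ) → ℝ}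
    (hp : ∀ (a : ℝ) x, p (a • x) = |a| * p x)
    (hpack : ∀ (ρ : ℝ) (T : Finset (Fin d → ℝ)), (∀ t ∈ T, t ⬝ᵥ t ≤ ρ) →
      (∀ t ∈ T, ∀ u ∈ T, t ≠ u → 2 < p (t - u)) → (T.card : ℝ) ≤ 4 * Real.exp ρ)
    {b : ℝ} (hb : 0 < b) {S : Finset (Fin d → ℝ)} (hS : ∀ z ∈ S, ∀ x, z ⬝ᵥ x ≤ p x)
    (hsep : ∀ x ∈ S, ∀ y ∈ S, x ≠ y → b ≤ (x - y) ⬝ᵥ (x - y)) :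
    (S.card : ℝ) ≤ Real.exp (10000 / b) := by
  classical
  obtain ⟨k, hk⟩ : ∃ k : ℕ, 3600 < 4 ^ k * b := by
    obtain ⟨k, hk⟩ := pow_unbounded_of_one_lt (3600 / b) (by norm_num : (1 : ℝ) < 4)
    exact ⟨k, (div_lt_iff₀ hb).1 hk⟩
  induction k generalizing b S with
  | zero =>
    calc (S.card : ℝ) ≤ 1 := by
          exact_mod_cast card_le_one_of_packing hp hpack (by simpa using hk) hS hsep
      _ ≤ _ := Real.one_le_exp (by positivity)
  | succ k ih =>
    rcases lt_or_ge 3600 b with hlarge | hsmall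
    · calc (S.card : ℝ) ≤ 1 := by exact_mod_cast card_le_one_of_packing hp hpack hlarge hS hsep
        _ ≤ _ := Real.one_le_exp (by positivity)
    obtain ⟨S', hsub, hsep', hnet⟩ := exists_net S (b := 4 * b) (by positivity)
    have hS' := ih (b := 4 * b) (by positivity) (fun z hz => hS z (hsub hz)) hsep'
      (by rw [pow_succ] at hk; linarith)
    choose! f hf hfd using hnet
    have hfib : ∀ y ∈ S', (S.filter fun x => f x = y).card ≤ ⌊4 * Real.exp (100 / b)⌋₊ := by
      intro y _
      refine Nat.le_floor (card_le_of_shrinking_radius hp hpack hb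
        (fun z hz => hS z (Finset.mem_filter.1 hz).1)
        (fun x hx x' hx' => hsep x (Finset.mem_filter.1 hx).1 x' (Finset.mem_filter.1 hx').1)
        y fun x hx => ?_)
      obtain ⟨hxS, rfl⟩ := Finset.mem_filter.1 hx
      exact hfd x hxS
    have hfour : (4 : ℝ) ≤ Real.exp (7200 / b) := by
      have h1 : (2 : ℝ) ≤ Real.exp 1 := by linarith [Real.add_one_le_exp (1 : ℝ)]
      have h2 : (2 : ℝ) ≤ 7200 / b := by rw [le_div_iff₀ hb]; linarith
      calc (4 : ℝ) = 2 * 2 := by norm_num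
        _ ≤ Real.exp 1 * Real.exp 1 := by gcongr
        _ = Real.exp 2 := by rw [← Real.exp_add]; norm_num
        _ ≤ _ := Real.exp_le_exp.2 h2
    calc (S.card : ℝ) ≤ (⌊4 * Real.exp (100 / b)⌋₊ : ℝ) * S'.card := by
          exact_mod_cast Finset.card_le_mul_card_image_of_maps_to hf _ hfib
      _ ≤ Real.exp (7200 / b) * Real.exp (100 / b) * Real.exp (10000 / (4 * b)) := by
          gcongr
          exact (Nat.floor_le (by positivity)).trans (by gcongr)
      _ = Real.exp (9800 / b) := by
          rw [← Real.exp_add, ← Real.exp_add]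
          congr 1
          field_simp
          norm_num
      _ ≤ Real.exp (10000 / b) := by gcongr; norm_num

lemma measurable_of_isNorm {d : ℕ} {nrm : (Fin d → ℝ) → ℝ}
    (hadd : ∀ x y, nrm (x + y) ≤ nrm x + nrm y)
    (hsmul : ∀ (a : ℝ) (x : Fin d → ℝ), nrm (a • x) = |a| * nrm x) : Measurable nrm := by
  have hconv : ConvexOn ℝ Set.univ nrm := by
    refine ⟨convex_univ, fun x _ y _ a b ha hb _ => (hadd _ _).trans_eq ?_⟩
    rw [hsmul, hsmul, abs_of_nonneg ha, abs_of_nonneg hb, smul_eq_mul, smul_eq_mul]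
  exact hconv.locallyLipschitz.continuous.measurable

/-- An estimator of accuracy `ε` with confidence `1/2` on `T` bounds the size of `T` in terms of
its radius, if `T` is `2ε`-separated. -/
lemma card_le_of_estimator {d N : ℕ} {nrm : (Fin d → ℝ) → ℝ}
    (hadd : ∀ x y, nrm (x + y) ≤ nrm x + nrm y)
    (hsmul : ∀ (a : ℝ) (x : Fin d → ℝ), nrm (a • x) = |a| * nrm x)
    {Ψ : (Fin N → Fin d → ℝ) → (Fin d → ℝ)} (hΨ : Measurable Ψ) {ε ρ : ℝ}
    {T : Finset (Fin d → ℝ)} (hT : ∀ t ∈ T, N * (t ⬝ᵥ t) ≤ ρ)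
    (hsep : ∀ t ∈ T, ∀ u ∈ T, t ≠ u → 2 * ε < nrm (t - u))
    (hacc : ∀ t ∈ T, (1/2 : ℝ≥0∞) ≤
      (Measure.pi fun _ : Fin N => Measure.map (fun x => x + t) (_root_.stdGaussian d))
        {x | nrm (Ψ x - t) ≤ ε}) :
    (T.card : ℝ) ≤ 4 * Real.exp ρ := by
  have : IsProbabilityMeasure (_root_.stdGaussian d) :=
    inferInstanceAs (IsProbabilityMeasure (Measure.pi fun _ : Fin d => gaussianReal 0 1))
  have hcard := card_le_of_hasSqDensity (P := Measure.pi fun _ : Fin N => _root_.stdGaussian d)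
    (C := ENNReal.ofReal (Real.exp ρ)) (T := T) (A := fun t => {x | nrm (Ψ x - t) ≤ ε})
    (fun t ht => by
      obtain ⟨f, hf, hd, hC⟩ := hasSqDensity_gaussian_sample N t
      exact ⟨f, hf, hd, hC.trans (ENNReal.ofReal_le_ofReal (Real.exp_le_exp.2 (hT t ht)))⟩)
    (fun t _ => measurableSet_le
      ((measurable_of_isNorm hadd hsmul).comp (hΨ.sub_const t)) measurable_const)
    (fun t ht u hu htu => Set.disjoint_left.2 fun x (hx : nrm (Ψ x - t) ≤ ε)
        (hx' : nrm (Ψ x - u) ≤ ε) => by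
      have h1 := hsep t ht u hu htu
      have h2 := hadd (t - Ψ x) (Ψ x - u)
      have h3 : nrm (t - Ψ x) = nrm (Ψ x - t) := by
        have := hsmul (-1) (Ψ x - t)
        simpa using this
      rw [sub_add_sub_cancel] at h2
      linarith)
    hacc
  rw [← ENNReal.ofReal_natCast, show (4 : ℝ≥0∞) = ENNReal.ofReal 4 by norm_num,
    ← ENNReal.ofReal_mul (by norm_num), ENNReal.ofReal_le_ofReal_iff (by positivity)] at hcard
  exact hcard

lemma dotProduct_le_of_mem_dualBall {d : ℕ} {nrm : (Fin d → ℝ) → ℝ}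
    (hsmul : ∀ (a : ℝ) (x : Fin d → ℝ), nrm (a • x) = |a| * nrm x)
    (hpos : ∀ x, x ≠ 0 → 0 < nrm x) {z : Fin d → ℝ} (hz : z ∈ dualBall nrm) (x : Fin d → ℝ) :
    z ⬝ᵥ x ≤ nrm x := by
  rcases eq_or_ne x 0 with rfl | hx
  · have : nrm (0 : Fin d → ℝ) = 0 := by simpa using hsmul 0 0
    simp [this]
  have hx' := hpos x hx
  have h1 : z ⬝ᵥ ((nrm x)⁻¹ • x) ≤ 1 := hz _ <| by
    rw [hsmul, abs_of_pos (by positivity), inv_mul_cancel₀ hx'.ne']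
  rwa [dotProduct_smul, smul_eq_mul, inv_mul_le_iff₀ hx', mul_one] at h1

/-- **Lower bound (Theorem 4).** There exist absolute constants `c₁, c₂` such that the
following holds. Let `‖·‖` be a norm on `ℝ^d` with dual unit ball `B°`, let `ν` be the law of
the standard Gaussian vector `G`, let `D = B₂^d` and `n ≤ N`. If `log M(B°, ηD) ≥ c₁ n`,
i.e. `B°` contains an `η`-separated (in the Euclidean metric) subset `S` with
`log |S| ≥ c₁ n`, then there is a finite set `T ⊂ ℝ^d` such that no measurable mean
estimator `Ψ̂_N : (ℝ^d)^N → ℝ^d` can satisfy, simultaneously for every `t ∈ T`,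
`P(‖Ψ̂_N(X₁,…,X_N) - t‖ ≤ c₂ η √(n/N)) ≥ 1/2` when `X₁,…,X_N` are i.i.d. with the law of
`G + t`. -/
theorem lower_bound_gaussian_shift :
    ∃ c₁ : ℝ, 0 < c₁ ∧ ∃ c₂ : ℝ, 0 < c₂ ∧
    ∀ (d n N : ℕ), 0 < n → n ≤ N →
    ∀ nrm : (Fin d → ℝ) → ℝ,
    (∀ x y, nrm (x + y) ≤ nrm x + nrm y) →
    (∀ (a : ℝ) (x : Fin d → ℝ), nrm (a • x) = |a| * nrm x) →
    (∀ x, x ≠ 0 → 0 < nrm x) →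
    ∀ η : ℝ, 0 < η →
    -- log M(B°, ηD) ≥ c₁ n
    (∃ S : Finset (Fin d → ℝ), ↑S ⊆ dualBall nrm ∧
      (∀ x ∈ S, ∀ y ∈ S, x ≠ y → η ≤ Real.sqrt (∑ i, (x i - y i)^2)) ∧
      c₁ * n ≤ Real.log S.card) →
    ∃ T : Finset (Fin d → ℝ),
      ∀ Ψ : (Fin N → Fin d → ℝ) → (Fin d → ℝ), Measurable Ψ →
        ¬ (∀ t ∈ T, (1/2 : ℝ≥0∞) ≤
            (Measure.pi fun _ : Fin N => Measure.map (fun x => x + t) (stdGaussian d))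
              {x | nrm (Ψ x - t) ≤ c₂ * η * Real.sqrt (n / N)}) := by
  classical
  refine ⟨10001, by norm_num, 1, one_pos, ?_⟩
  rintro d n N hn hnN nrm hadd hsmul hpos η hη ⟨S, hSB, hSsep, hScard⟩
  by_contra! hT
  have hn' : (0 : ℝ) < n := by exact_mod_cast hn
  have hN' : (0 : ℝ) < N := by exact_mod_cast hn.trans_le hnN
  have hsN : 0 < √(N : ℝ) := Real.sqrt_pos.2 hN'
  set s : ℝ := η * √n with hs_def
  have hs : 0 < s := mul_pos hη (Real.sqrt_pos.2 hn')
  have hp : ∀ (a : ℝ) (x : Fin d → ℝ), nrm (a • x) / s = |a| * (nrm x / s) := fun a x => by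
    rw [hsmul, mul_div_assoc]
  have hpack : ∀ (ρ : ℝ) (T : Finset (Fin d → ℝ)), (∀ t ∈ T, t ⬝ᵥ t ≤ ρ) →
      (∀ t ∈ T, ∀ u ∈ T, t ≠ u → 2 < nrm (t - u) / s) → (T.card : ℝ) ≤ 4 * Real.exp ρ := by
    intro ρ T hρ hsep
    obtain ⟨Ψ, hΨ, hacc⟩ := hT (T.image fun t => (√(N : ℝ))⁻¹ • t)
    rw [← Finset.card_image_of_injective T
      (smul_right_injective (Fin d → ℝ) (inv_ne_zero hsN.ne'))]
    refine card_le_of_estimator hadd hsmul hΨ ?_ ?_ hacc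
    · simp only [Finset.forall_mem_image, smul_dotProduct, dotProduct_smul, smul_eq_mul]
      intro t ht
      rw [← mul_assoc (√(N : ℝ))⁻¹, ← mul_inv, Real.mul_self_sqrt hN'.le,
        mul_inv_cancel_left₀ hN'.ne']
      exact hρ t ht
    · simp only [Finset.forall_mem_image]
      intro t ht u hu hne
      have h1 := (lt_div_iff₀ hs).1 (hsep t ht u hu fun h => hne (by rw [h]))
      rw [← smul_sub, hsmul, abs_of_pos (inv_pos.2 hsN), Real.sqrt_div hn'.le]
      calc 2 * (1 * η * (√n / √N)) = (√(N : ℝ))⁻¹ * (2 * s) := by rw [hs_def]; ring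
        _ < _ := by gcongr
  have hinj := smul_right_injective (Fin d → ℝ) (inv_ne_zero hs.ne')
  have hcard := card_le_exp_of_packing hp hpack (b := 1 / n) (by positivity)
    (S := S.image fun z => s⁻¹ • z) (by
      simp only [Finset.forall_mem_image, smul_dotProduct, smul_eq_mul]
      intro z hz x
      rw [inv_mul_eq_div]
      exact div_le_div_of_nonneg_right (dotProduct_le_of_mem_dualBall hsmul hpos (hSB hz) x) hs.le) (by
      simp only [Finset.forall_mem_image]
      intro x hx y hy hne
      have h1 := (Real.le_sqrt' hη).1 (hSsep x hx y hy fun h => hne (by rw [h]))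
      have h2 : ∑ i, (x i - y i) ^ 2 = (x - y) ⬝ᵥ (x - y) := by simp [dotProduct, sq]
      rw [h2] at h1
      rw [← smul_sub, smul_dotProduct, dotProduct_smul, smul_eq_mul, smul_eq_mul]
      have hs2 : s * s = η ^ 2 * n := by
        rw [hs_def, mul_mul_mul_comm, Real.mul_self_sqrt hn'.le, sq]
      calc 1 / (n : ℝ) = s⁻¹ * (s⁻¹ * η ^ 2) := by
            rw [← mul_assoc, ← mul_inv, hs2]; field_simp
        _ ≤ _ := by gcongr)
  rw [Finset.card_image_of_injective S hinj] at hcard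
  have hlog : Real.log S.card ≤ 10000 * n := by
    rcases Nat.eq_zero_or_pos S.card with h0 | h0
    · rw [h0]; simp
    · rw [Real.log_le_iff_le_exp (by exact_mod_cast h0)]
      simpa using hcard
  linarith
end

section
/- Let ‖·‖ be a norm on ℝ^d, let T be the set of extreme points of the unit ball of the dual norm, let z₁,…,z_n ∈ ℝ^d and r > 0. Define S = { y ∈ ℝ^d : for every x* ∈ T, |x*(z_j) − x*(y)| ≤ r for more than n/2 of the indices j ∈ {1,…,n} }. Then for any y, y' ∈ S one has ‖y − y'‖ ≤ 2r; that is, S has diameter at most 2r in the norm ‖·‖. -/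
open scoped Classical

theorem sum_mul_le_of_mem_dualBall {d : ℕ} {nrm : (Fin d → ℝ) → ℝ}
    (hnrm_smul : ∀ (a : ℝ) (x : Fin d → ℝ), nrm (a • x) = |a| * nrm x)
    (hnrm_pos : ∀ x, x ≠ 0 → 0 < nrm x)
    {t : Fin d → ℝ} (ht : t ∈ dualBall nrm) (x : Fin d → ℝ) :
    ∑ i, t i * x i ≤ nrm x := by
  rcases eq_or_ne x 0 with rfl | hx
  · have h0 : nrm 0 = 0 := by simpa using hnrm_smul 0 0
    simp [h0]
  · have hpos := hnrm_pos x hx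
    have h := ht ((nrm x)⁻¹ • x) (by
      rw [hnrm_smul, abs_of_pos (inv_pos.2 hpos), inv_mul_cancel₀ hpos.ne'])
    have hsum : ∑ i, t i * ((nrm x)⁻¹ • x) i = (nrm x)⁻¹ * ∑ i, t i * x i := by
      rw [Finset.mul_sum]
      refine Finset.sum_congr rfl fun i _ => ?_
      simp only [Pi.smul_apply, smul_eq_mul]
      ring
    rwa [hsum, inv_mul_le_iff₀ hpos, mul_one] at h

theorem isCompact_dualBall {d : ℕ} {nrm : (Fin d → ℝ) → ℝ}
    (hnrm_smul : ∀ (a : ℝ) (x : Fin d → ℝ), nrm (a • x) = |a| * nrm x)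
    (hnrm_pos : ∀ x, x ≠ 0 → 0 < nrm x) :
    IsCompact (dualBall nrm) := by
  have hclosed : IsClosed (dualBall nrm) := by
    simp only [dualBall, Set.ofPred_forall]
    exact isClosed_iInter fun x => isClosed_iInter fun _ =>
      isClosed_le (by fun_prop) continuous_const
  refine IsCompact.of_isClosed_subset (isCompact_Icc
    (a := fun i => -nrm (-Pi.single i 1)) (b := fun i => nrm (Pi.single i 1)))
    hclosed fun t ht => ⟨fun i => ?_, fun i => ?_⟩
  · have h := sum_mul_le_of_mem_dualBall hnrm_smul hnrm_pos ht (-Pi.single i 1)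
    simp [Pi.single_apply] at h
    simpa using neg_le.1 h
  · simpa [Pi.single_apply] using
      sum_mul_le_of_mem_dualBall hnrm_smul hnrm_pos ht (Pi.single i 1)

theorem exists_mem_dualBall_sum_mul_eq {d : ℕ} {nrm : (Fin d → ℝ) → ℝ}
    (hnrm_add : ∀ x y, nrm (x + y) ≤ nrm x + nrm y)
    (hnrm_smul : ∀ (a : ℝ) (x : Fin d → ℝ), nrm (a • x) = |a| * nrm x)
    (hnrm_pos : ∀ x, x ≠ 0 → 0 < nrm x)
    {v : Fin d → ℝ} (hv : v ≠ 0) :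
    ∃ t ∈ dualBall nrm, ∑ i, t i * v i = nrm v := by
  obtain ⟨g, hgf, hg⟩ := exists_extension_of_le_sublinear
    (LinearPMap.mkSpanSingleton v (nrm v) hv) nrm
    (fun c hc x => by rw [hnrm_smul, abs_of_pos hc]) hnrm_add (by
      rintro ⟨x, hx⟩
      obtain ⟨a, rfl⟩ := Submodule.mem_span_singleton.1 hx
      rw [LinearPMap.mkSpanSingleton'_apply, hnrm_smul, smul_eq_mul]
      exact mul_le_mul_of_nonneg_right (le_abs_self a) (hnrm_pos v hv).le)
  have hsum (x : Fin d → ℝ) : ∑ i, g (Pi.single i 1) * x i = g x := by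
    rw [LinearMap.pi_apply_eq_sum_univ g x]
    refine Finset.sum_congr rfl fun i _ => ?_
    rw [smul_eq_mul, mul_comm]
    congr 2
    ext j
    simp [Pi.single_apply, eq_comm]
  refine ⟨fun i => g (Pi.single i 1), fun x hx => ?_, ?_⟩
  · rw [hsum]
    exact (hg x).trans hx
  · rw [hsum]
    have h := hgf ⟨v, Submodule.mem_span_singleton_self v⟩
    rw [LinearPMap.mkSpanSingleton_apply] at h
    exact h

/-- The norm of a nonzero vector is attained at an extreme point of the dual unit ball. -/
theorem exists_mem_extremePoints_dualBall_sum_mul_eq {d : ℕ} {nrm : (Fin d → ℝ) → ℝ}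
    (hnrm_add : ∀ x y, nrm (x + y) ≤ nrm x + nrm y)
    (hnrm_smul : ∀ (a : ℝ) (x : Fin d → ℝ), nrm (a • x) = |a| * nrm x)
    (hnrm_pos : ∀ x, x ≠ 0 → 0 < nrm x)
    {v : Fin d → ℝ} (hv : v ≠ 0) :
    ∃ t ∈ Set.extremePoints ℝ (dualBall nrm), ∑ i, t i * v i = nrm v := by
  obtain ⟨t₀, ht₀, ht₀v⟩ := exists_mem_dualBall_sum_mul_eq hnrm_add hnrm_smul hnrm_pos hv
  have hle {t : Fin d → ℝ} (ht : t ∈ dualBall nrm) : ∑ i, t i * v i ≤ nrm v :=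
    sum_mul_le_of_mem_dualBall hnrm_smul hnrm_pos ht v
  let l : StrongDual ℝ (Fin d → ℝ) := ∑ i, v i • ContinuousLinearMap.proj i
  have hl (t : Fin d → ℝ) : l t = ∑ i, t i * v i := by
    simp [l, mul_comm]
  have hexp : IsExposed ℝ (dualBall nrm) (l.toExposed (dualBall nrm)) :=
    ContinuousLinearMap.toExposed.isExposed
  have hne : (l.toExposed (dualBall nrm)).Nonempty :=
    ⟨t₀, ht₀, fun t ht => by rw [hl, hl, ht₀v]; exact hle ht⟩
  obtain ⟨t, ht⟩ :=
    (hexp.isCompact (isCompact_dualBall hnrm_smul hnrm_pos)).extremePoints_nonempty hne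
  refine ⟨t, hexp.isExtreme.extremePoints_subset_extremePoints ht, ?_⟩
  have hmax := ht.1.2 t₀ ht₀
  rw [hl, hl, ht₀v] at hmax
  exact le_antisymm (hle ht.1.1) hmax

/-- **Diameter of the intersection of slabs.** Let `‖·‖` be a norm on `ℝ^d`, `T` the set of
extreme points of the dual unit ball, `z₁,…,z_n ∈ ℝ^d` and `r > 0`. If
`S = {y : ∀ x* ∈ T, |x*(z_j) - x*(y)| ≤ r for more than n/2 of the indices j}`, then any
two points `y, y' ∈ S` satisfy `‖y - y'‖ ≤ 2r`: the set `S` has diameter at most `2r`. -/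
theorem slab_intersection_diameter {d n : ℕ}
    (nrm : (Fin d → ℝ) → ℝ)
    (hnrm_add : ∀ x y, nrm (x + y) ≤ nrm x + nrm y)
    (hnrm_smul : ∀ (a : ℝ) (x : Fin d → ℝ), nrm (a • x) = |a| * nrm x)
    (hnrm_pos : ∀ x, x ≠ 0 → 0 < nrm x)
    (z : Fin n → Fin d → ℝ) (r : ℝ) (hr : 0 < r)
    (y y' : Fin d → ℝ)
    (hy : ∀ t ∈ Set.extremePoints ℝ (dualBall nrm),
      (n : ℝ) < 2 * (Finset.univ.filter fun j =>
        |(∑ k, t k * z j k) - ∑ k, t k * y k| ≤ r).card)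
    (hy' : ∀ t ∈ Set.extremePoints ℝ (dualBall nrm),
      (n : ℝ) < 2 * (Finset.univ.filter fun j =>
        |(∑ k, t k * z j k) - ∑ k, t k * y' k| ≤ r).card) :
    nrm (y - y') ≤ 2 * r := by
  rcases eq_or_ne (y - y') 0 with h0 | h0
  · have hzero : nrm 0 = 0 := by simpa using hnrm_smul 0 0
    rw [h0, hzero]
    positivity
  obtain ⟨t, ht, htv⟩ :=
    exists_mem_extremePoints_dualBall_sum_mul_eq hnrm_add hnrm_smul hnrm_pos h0
  let slab (w : Fin d → ℝ) : Finset (Fin n) :=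
    Finset.univ.filter fun j => |(∑ k, t k * z j k) - ∑ k, t k * w k| ≤ r
  have hcard : n < (slab y).card + (slab y').card := by
    have h₁ : (n : ℝ) < 2 * (slab y).card := hy t ht
    have h₂ : (n : ℝ) < 2 * (slab y').card := hy' t ht
    exact_mod_cast (by linarith : (n : ℝ) < (slab y).card + (slab y').card)
  obtain ⟨j, hj⟩ := Finset.inter_nonempty_of_card_lt_card_add_card
    (Finset.subset_univ (slab y)) (Finset.subset_univ (slab y')) (by simpa using hcard)
  simp only [slab, Finset.mem_inter, Finset.mem_filter, Finset.mem_univ, true_and] at hj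
  have hsub : ∑ i, t i * (y - y') i = ∑ i, t i * y i - ∑ i, t i * y' i := by
    simp [mul_sub]
  rw [← htv, hsub]
  linarith [(abs_le.1 hj.1).1, (abs_le.1 hj.2).2]
end
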